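/- arXiv:1006.1587 — 5 statements merged into one kernel-verified Lean document; each statement's English description precedes it below -/
import Mathlib

section
/- For every digraph D, the hat number of D satisfies h(D) ≤ ω(D)/(ω(D)+1), where ω(D) is the clique number of D. -/
namespace HatProblem

variable {V : Type*} [Fintype V] [DecidableEq V]

/-- A team strategy: each vertex maps a full configuration to a guess (`none` = pass),
depending only on the colors of its out-neighbors. -/
def IsStrategy (A : V → V → Prop) (S : V → (V → Bool) → Option Bool) : Prop :=
  ∀ (v : V) (c c' : V → Bool), (∀ u, A v u → c u = c' u) → S v c = S v c'

/-- The team wins at configuration `c`: someone guesses correctly, nobody guesses wrong. -/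
def Wins (S : V → (V → Bool) → Option Bool) (c : V → Bool) : Prop :=
  (∃ v, S v c = some (c v)) ∧ ∀ v b, S v c = some b → b = c v

/-- The chance of success of a strategy. -/
noncomputable def chance (S : V → (V → Bool) → Option Bool) : ℚ :=
  ({c : V → Bool | Wins S c}.ncard : ℚ) / 2 ^ Fintype.card V

/-- The hat number of a digraph: the maximal chance of success over all strategies. -/
noncomputable def hatNumber (A : V → V → Prop) : ℚ :=
  haveI : Fintype {S : V → (V → Bool) → Option Bool // IsStrategy A S} :=
    Fintype.ofFinite _
  Finset.sup' (Finset.univ : Finset {S : V → (V → Bool) → Option Bool // IsStrategy A S})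
    ⟨⟨fun _ _ => none, fun _ _ _ _ => rfl⟩, Finset.mem_univ _⟩
    fun S => chance S.1

/-- A clique in the skeleton of a digraph: vertices pairwise joined by arcs both ways. -/
def IsDiClique (A : V → V → Prop) (s : Finset V) : Prop :=
  ∀ x ∈ s, ∀ y ∈ s, x ≠ y → A x y ∧ A y x

/-- The clique number of a digraph: the clique number of its skeleton. -/
noncomputable def cliqueNum (A : V → V → Prop) : ℕ :=
  sSup {n | ∃ s : Finset V, IsDiClique A s ∧ s.card = n}

/-- The directed union `C → D` of two digraphs. -/
def dUnion {W : Type*} (A : V → V → Prop) (B : W → W → Prop) :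
    V ⊕ W → V ⊕ W → Prop
  | Sum.inl x, Sum.inl y => A x y
  | Sum.inl _, Sum.inr _ => True
  | Sum.inr _, Sum.inl _ => False
  | Sum.inr x, Sum.inr y => B x y

/-- The complete digraph on `m` vertices. -/
def completeArc (m : ℕ) : Fin m → Fin m → Prop := fun a b => a ≠ b

end HatProblem

namespace HatProblem

/-- Change the color of the single vertex `v`. -/
def flip {V : Type*} [DecidableEq V] (c : V → Bool) (v : V) : V → Bool :=
  Function.update c v (!c v)

theorem flip_apply_self {V : Type*} [DecidableEq V] (c : V → Bool) (v : V) :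
    flip c v v = !c v := by
  simp [flip]

theorem flip_apply_of_ne {V : Type*} [DecidableEq V] (c : V → Bool) {v u : V} (h : u ≠ v) :
    flip c v u = c u := by
  simp [flip, h]

theorem flip_flip {V : Type*} [DecidableEq V] (c : V → Bool) (v : V) :
    flip (flip c v) v = c := by
  simp [flip]

/-- A vertex that does not see `v` does not react to a change of the color of `v`. -/
theorem IsStrategy.flip_eq {V : Type*} [DecidableEq V] {A : V → V → Prop}
    {S : V → (V → Bool) → Option Bool} (hS : IsStrategy A S) {x v : V} (h : ¬A x v)
    (c : V → Bool) : S x (flip c v) = S x c :=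
  hS x _ _ fun _ hu => flip_apply_of_ne c fun e => h (e ▸ hu)

theorem IsDiClique.card_le_cliqueNum {V : Type*} [Fintype V] {A : V → V → Prop}
    {s : Finset V} (hs : IsDiClique A s) : s.card ≤ cliqueNum A := by
  refine le_csSup ⟨Fintype.card V, ?_⟩ ⟨s, hs, rfl⟩
  rintro _ ⟨t, -, rfl⟩
  exact t.card_le_univ

/-- If `y` guesses correctly in the winning configuration `flip b y`, and `x ≠ y` guesses correctly
in `flip b x`, then `x` sees `y`. -/
theorem IsStrategy.arc_of_wins_flip {V : Type*} [DecidableEq V] {A : V → V → Prop}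
    {S : V → (V → Bool) → Option Bool} (hA : ∀ v, ¬A v v) (hS : IsStrategy A S)
    {b : V → Bool} {x y : V} (hxy : x ≠ y) (hx : S x (flip b x) = some (flip b x x))
    (hy : Wins S (flip b y)) : A x y := by
  by_contra h
  rw [hS.flip_eq (hA x), flip_apply_self] at hx
  have := hy.2 x (!b x) (by rw [hS.flip_eq h, hx])
  rw [flip_apply_of_ne b hxy] at this
  simp at this

/-- The winning configurations are at most `cliqueNum A` times as many as the losing ones. -/
theorem IsStrategy.card_wins_le {V : Type*} [Fintype V] [DecidableEq V] {A : V → V → Prop}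
    {S : V → (V → Bool) → Option Bool} [DecidablePred (Wins S)] (hA : ∀ v, ¬A v v)
    (hS : IsStrategy A S) :
    (Finset.univ.filter (Wins S)).card ≤
      cliqueNum A * (Finset.univ.filter fun c => ¬Wins S c).card := by
  have hg : ∀ c : {c // Wins S c}, ∃ v, S v c = some (c.1 v) := fun c => c.2.1
  choose g hg using hg
  rw [← Fintype.card_subtype, Fintype.card]
  refine Finset.card_le_mul_card_image_of_maps_to (f := fun c => flip c.1 (g c)) ?_ _ ?_
  · intro c _
    refine Finset.mem_filter.2 ⟨Finset.mem_univ _, fun h => ?_⟩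
    have := h.2 (g c) (c.1 (g c)) (by rw [hS.flip_eq (hA _), hg])
    rw [flip_apply_self] at this
    simp at this
  · intro b _
    have key : ∀ c ∈ Finset.univ.filter fun c => flip c.1 (g c) = b, c.1 = flip b (g c) := by
      intro c hc
      rw [← (Finset.mem_filter.1 hc).2, flip_flip]
    rw [← Finset.card_image_of_injOn (f := g)]
    · refine IsDiClique.card_le_cliqueNum fun x hx y hy hxy => ?_
      obtain ⟨c, hc, rfl⟩ := Finset.mem_image.1 hx
      obtain ⟨d, hd, rfl⟩ := Finset.mem_image.1 hy
      have hc₁ := hg c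
      have hd₁ := hg d
      have hc₂ := c.2
      have hd₂ := d.2
      rw [key c hc] at hc₁ hc₂
      rw [key d hd] at hd₁ hd₂
      exact ⟨hS.arc_of_wins_flip hA hxy hc₁ hd₂, hS.arc_of_wins_flip hA hxy.symm hd₁ hc₂⟩
    · intro c hc d hd h
      exact Subtype.ext (by rw [key c hc, key d hd, h])

/-- For every digraph `D` we have `h(D) ≤ ω(D)/(ω(D)+1)`. -/
theorem hatNumber_le_cliqueNum_ratio {V : Type*} [Fintype V] [DecidableEq V]
    (A : V → V → Prop) (hA : Irreflexive A) :
    hatNumber A ≤ (cliqueNum A : ℚ) / ((cliqueNum A : ℚ) + 1) := by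
  classical
  refine Finset.sup'_le _ _ fun S _ => ?_
  have hle := S.2.card_wins_le hA
  have hsum := Finset.card_filter_add_card_filter_not (s := Finset.univ) (Wins S.1)
  rw [Finset.card_univ, Fintype.card_fun, Fintype.card_bool] at hsum
  have hset : {c : V → Bool | Wins S.1 c}.ncard = (Finset.univ.filter (Wins S.1)).card := by
    rw [← Set.ncard_coe_finset]
    simp
  rw [chance, hset, div_le_div_iff₀ (by positivity) (by positivity)]
  exact_mod_cast (by rw [← hsum]; linarith :
    (Finset.univ.filter (Wins S.1)).card * (cliqueNum A + 1) ≤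
      cliqueNum A * 2 ^ Fintype.card V)

end HatProblem
end

section
/- Let D be a digraph and let S be any strategy for the hat problem on D. Let W_S be the set of configurations at which the team wins using S, and let L_S be the set of configurations at which at least one vertex guesses wrong using S. Then |W_S| ≤ ω(D)·|L_S|. -/
namespace HatProblem

/-- The configuration `c` with the color of `v` reversed. -/
def flipAt {V : Type*} [DecidableEq V] (c : V → Bool) (v : V) : V → Bool :=
  Function.update c v (!c v)

section flipAt

variable {V : Type*} [DecidableEq V]

@[simp]
theorem flipAt_self (c : V → Bool) (v : V) : flipAt c v v = !c v := by simp [flipAt]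

theorem flipAt_of_ne (c : V → Bool) {u v : V} (h : u ≠ v) : flipAt c v u = c u := by
  simp [flipAt, h]

@[simp]
theorem flipAt_flipAt (c : V → Bool) (v : V) : flipAt (flipAt c v) v = c := by
  simp [flipAt]

/-- A vertex that does not see `v` guesses the same after the color of `v` is reversed. -/
theorem IsStrategy.apply_flipAt {A : V → V → Prop} {S : V → (V → Bool) → Option Bool}
    (hS : IsStrategy A S) {u v : V} (h : ¬A u v) (c : V → Bool) :
    S u (flipAt c v) = S u c :=
  hS u _ _ fun _ hw => flipAt_of_ne c fun e => h (e ▸ hw)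

/-- If `x` and `y` both guess wrong at `c` and the team wins once the color of `x` is reversed,
then `y` sees `x`. -/
theorem IsStrategy.arc_of_wins_flipAt {A : V → V → Prop} {S : V → (V → Bool) → Option Bool}
    (hS : IsStrategy A S) {c : V → Bool} {x y : V} (hne : x ≠ y)
    (hy : S y c = some (!c y)) (hx : Wins S (flipAt c x)) : A y x := by
  by_contra h
  have := hx.2 y _ ((hS.apply_flipAt h c).trans hy)
  simp [flipAt_of_ne c hne.symm] at this

end flipAt

/-- For any strategy `S` on a digraph `D`, the number of winning configurations is at most
`ω(D)` times the number of configurations with at least one wrong guess. -/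
theorem winCount_le_cliqueNum_mul_loseCount {V : Type*} [Fintype V] [DecidableEq V]
    (A : V → V → Prop) (hA : Irreflexive A)
    (S : V → (V → Bool) → Option Bool) (hS : IsStrategy A S) :
    {c : V → Bool | Wins S c}.ncard ≤
      cliqueNum A * {c : V → Bool | ∃ v b, S v c = some b ∧ b ≠ c v}.ncard := by
  classical
  have hcorrect : ∀ c : {c : V → Bool // Wins S c}, ∃ v, S v c.1 = some (c.1 v) := fun c => c.2.1
  choose g hg using hcorrect
  have hflip (c : {c : V → Bool // Wins S c}) :
      S (g c) (flipAt c.1 (g c)) = some (!flipAt c.1 (g c) (g c)) := by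
    rw [hS.apply_flipAt (fun h => hA (g c) h), hg]
    simp
  rw [Set.ncard_eq_toFinset_card' {c : V → Bool | ∃ v b, S v c = some b ∧ b ≠ c v},
    ← Nat.card_coe_set_eq, Nat.card_eq_fintype_card, ← Finset.card_univ]
  refine Finset.card_le_mul_card_image_of_maps_to
    (f := fun c : {c : V → Bool // Wins S c} => flipAt c.1 (g c)) (fun c _ => ?_) _
    fun l _ => ?_
  · simp only [Set.mem_toFinset, Set.mem_ofPred_eq]
    exact ⟨g c, _, hflip c, by simp⟩
  · rw [← Finset.card_image_of_injOn (f := g)]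
    · refine IsDiClique.card_le_cliqueNum fun x hx y hy hne => ?_
      have key : ∀ z ∈ Finset.image g {c | flipAt c.1 (g c) = l},
          S z l = some (!l z) ∧ Wins S (flipAt l z) := by
        intro z hz
        obtain ⟨c, hc, rfl⟩ := Finset.mem_image.1 hz
        obtain rfl : flipAt c.1 (g c) = l := by simpa using hc
        exact ⟨hflip c, by simpa using c.2⟩
      exact ⟨hS.arc_of_wins_flipAt hne.symm (key x hx).1 (key y hy).2,
        hS.arc_of_wins_flipAt hne (key y hy).1 (key x hx).2⟩
    · intro c hc d hd hcd
      simp only [Finset.coe_filter, Finset.mem_univ, true_and, Set.mem_ofPred_eq] at hc hd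
      apply Subtype.ext
      rw [← flipAt_flipAt c.1 (g c), ← flipAt_flipAt d.1 (g d), hc, hd, hcd]

end HatProblem
end

section
/- Let D be a digraph on at least two vertices and let v be a vertex of D. If there exists an optimal strategy S for D (i.e., P(S) = h(D)) in which v never attempts to guess its color (g_v(c) = pass for every configuration c), then h(D) = h(D − v), where D − v is the induced subdigraph of D on the vertex set V ∖ {v}. -/
namespace HatProblem

/-- The strategy on `D - v` obtained from `S` by fixing the color of `v` to be `b`. -/
def fixColor {V : Type*} [DecidableEq V] (v : V) (b : Bool)
    (S : V → (V → Bool) → Option Bool) :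
    {u : V // u ≠ v} → ({u : V // u ≠ v} → Bool) → Option Bool :=
  fun u c => S u.1 ((Equiv.funSplitAt v Bool).symm (b, c))

/-- The extension to `D` of a strategy on `D - v`, with `v` always passing. -/
def extendPass {V : Type*} [DecidableEq V] (v : V)
    (T : {u : V // u ≠ v} → ({u : V // u ≠ v} → Bool) → Option Bool) :
    V → (V → Bool) → Option Bool :=
  fun u c => if h : u = v then none else T ⟨u, h⟩ (fun w => c w.1)

theorem IsStrategy.fixColor {V : Type*} [Fintype V] [DecidableEq V]
    {A : V → V → Prop} {S : V → (V → Bool) → Option Bool}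
    (hS : IsStrategy A S) (v : V) (b : Bool) :
    IsStrategy (fun a b : {u : V // u ≠ v} => A a.1 b.1) (fixColor v b S) := by
  intro u c c' h
  refine hS _ _ _ fun w hw => ?_
  by_cases hwv : w = v
  · simp [hwv]
  · simpa [hwv] using h ⟨w, hwv⟩ hw

theorem IsStrategy.extendPass {V : Type*} [Fintype V] [DecidableEq V]
    {A : V → V → Prop} {v : V}
    {T : {u : V // u ≠ v} → ({u : V // u ≠ v} → Bool) → Option Bool}
    (hT : IsStrategy (fun a b : {u : V // u ≠ v} => A a.1 b.1) T) :
    IsStrategy A (extendPass v T) := by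
  intro u c c' h
  by_cases huv : u = v
  · simp [HatProblem.extendPass, huv]
  · simpa [HatProblem.extendPass, huv] using hT _ _ _ fun w hw => h w.1 hw

theorem fixColor_extendPass {V : Type*} [DecidableEq V]
    (v : V) (b : Bool)
    (T : {u : V // u ≠ v} → ({u : V // u ≠ v} → Bool) → Option Bool) :
    fixColor v b (extendPass v T) = T := by
  funext u c
  simp only [fixColor, extendPass, u.2, dite_false]
  congr 1
  funext w
  simp [w.2]

theorem wins_fixColor_iff {V : Type*} [DecidableEq V]
    {v : V} {S : V → (V → Bool) → Option Bool}
    (hpass : ∀ c : V → Bool, S v c = none) (b : Bool) (c : {u : V // u ≠ v} → Bool) :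
    Wins (fixColor v b S) c ↔ Wins S ((Equiv.funSplitAt v Bool).symm (b, c)) := by
  have hval (u : {u : V // u ≠ v}) : (Equiv.funSplitAt v Bool).symm (b, c) u.1 = c u := by
    simp [u.2]
  constructor
  · rintro ⟨⟨u, hu⟩, hw⟩
    refine ⟨⟨u.1, by rw [hval]; exact hu⟩, fun w d hd => ?_⟩
    by_cases hwv : w = v
    · subst hwv
      simp [hpass] at hd
    · exact (hw ⟨w, hwv⟩ d hd).trans (hval ⟨w, hwv⟩).symm
  · rintro ⟨⟨u, hu⟩, hw⟩
    have huv : u ≠ v := by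
      rintro rfl
      simp [hpass] at hu
    exact ⟨⟨⟨u, huv⟩, hu.trans (congrArg some (hval ⟨u, huv⟩))⟩,
      fun w d hd => (hw w.1 d hd).trans (hval w)⟩

/-- If `v` always passes, then the chance of success is the average over the colors of `v`. -/
theorem chance_eq_average_of_pass {V : Type*} [Fintype V] [DecidableEq V]
    {v : V} {S : V → (V → Bool) → Option Bool}
    (hpass : ∀ c : V → Bool, S v c = none) :
    chance S = (chance (fixColor v true S) + chance (fixColor v false S)) / 2 := by
  classical
  have hcount : {c | Wins S c}.ncard =
      {c | Wins (fixColor v true S) c}.ncard + {c | Wins (fixColor v false S) c}.ncard := by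
    simp only [Set.ncard_eq_toFinset_card', Set.toFinset_ofPred, Finset.card_filter,
      wins_fixColor_iff hpass]
    rw [← Equiv.sum_comp (Equiv.funSplitAt v Bool).symm, Fintype.sum_prod_type,
      Fintype.sum_bool]
  have hV : Fintype.card V = Fintype.card {u : V // u ≠ v} + 1 := by
    have : 0 < Fintype.card V := Fintype.card_pos_iff.2 ⟨v⟩
    rw [Fintype.card_subtype_compl, Fintype.card_subtype_eq]
    omega
  rw [chance, chance, chance, hcount, hV, pow_succ]
  push_cast
  field_simp

theorem chance_le_hatNumber {V : Type*} [Fintype V] [DecidableEq V]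
    {A : V → V → Prop} {S : V → (V → Bool) → Option Bool}
    (hS : IsStrategy A S) : chance S ≤ hatNumber A := by
  rw [hatNumber]
  refine Finset.le_sup'_of_le _ (b := ⟨S, hS⟩) ?_ ?_
  · exact @Finset.mem_univ _ (_) _
  · exact le_refl (chance S)

theorem hatNumber_le {V : Type*} [Fintype V] [DecidableEq V]
    {A : V → V → Prop} {r : ℚ}
    (h : ∀ S, IsStrategy A S → chance S ≤ r) : hatNumber A ≤ r :=
  Finset.sup'_le _ _ fun S _ => h S.1 S.2

theorem chance_extendPass {V : Type*} [Fintype V] [DecidableEq V]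
    (v : V)
    (T : {u : V // u ≠ v} → ({u : V // u ≠ v} → Bool) → Option Bool) :
    chance (extendPass v T) = chance T := by
  rw [chance_eq_average_of_pass (v := v) fun c => by simp [extendPass]]
  simp only [fixColor_extendPass]
  ring

/-- If some optimal strategy for `D` has a vertex `v` that never attempts to guess its
color, then `h(D) = h(D - v)`. -/
theorem hatNumber_eq_of_never_guess {V : Type*} [Fintype V] [DecidableEq V]
    (A : V → V → Prop) (hA : Irreflexive A) (hcard : 1 < Fintype.card V) (v : V)
    (S : V → (V → Bool) → Option Bool) (hS : IsStrategy A S)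
    (hopt : chance S = hatNumber A)
    (hpass : ∀ c : V → Bool, S v c = none) :
    hatNumber A = hatNumber (fun a b : {u : V // u ≠ v} => A a.1 b.1) := by
  apply le_antisymm
  · rw [← hopt, chance_eq_average_of_pass hpass]
    linarith [chance_le_hatNumber (hS.fixColor v true), chance_le_hatNumber (hS.fixColor v false)]
  · refine hatNumber_le fun T hT => ?_
    rw [← chance_extendPass]
    exact chance_le_hatNumber hT.extendPass

end HatProblem
end

section
/- Let D₁ be the digraph with vertex set {u, x, y} and arcs (x,y), (y,x), (u,x), (u,y). Then h(D₁) = 5/8. -/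
namespace HatProblem

/-- The digraph `D₁` on vertices `u = 0`, `x = 1`, `y = 2` with arcs
`(x,y)`, `(y,x)`, `(u,x)`, `(u,y)`. -/
def DOne : Fin 3 → Fin 3 → Prop := fun a b =>
  (a = 1 ∧ b = 2) ∨ (a = 2 ∧ b = 1) ∨ (a = 0 ∧ b = 1) ∨ (a = 0 ∧ b = 2)

instance {V : Type*} [Fintype V] [DecidableEq V]
    (S : V → (V → Bool) → Option Bool) (c : V → Bool) :
    Decidable (Wins S c) :=
  inferInstanceAs (Decidable (_ ∧ _))

theorem ncard_wins {V : Type*} [Fintype V] [DecidableEq V] (S : V → (V → Bool) → Option Bool) :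
    {c : V → Bool | Wins S c}.ncard = ∑ c, if Wins S c then 1 else 0 := by
  rw [← Finset.card_filter, ← Set.ncard_coe_finset]
  simp

theorem wins_congr {V : Type*} {S T : V → (V → Bool) → Option Bool} {c : V → Bool}
    (h : ∀ v, S v c = T v c) : Wins S c ↔ Wins T c := by
  simp only [Wins, h]

theorem sum_config_three (f : (Fin 3 → Bool) → ℕ) :
    ∑ c, f c = ∑ a, ∑ b, ∑ u, f ![u, a, b] := by
  have h : Function.Bijective fun t : Bool × Bool × Bool => ![t.2.2, t.1, t.2.1] := by
    decide
  rw [← h.sum_comp, Fintype.sum_prod_type]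
  simp only [Fintype.sum_prod_type]

/-- The most colors of `u` for which the team can win on `DOne` when `x`, `y` have colors `a`, `b`
and guess `p`, `q`. -/
def winBound (p q : Option Bool) (a b : Bool) : ℕ :=
  if p = some !a ∨ q = some !b then 0 else if p = none ∧ q = none then 1 else 2

theorem sum_wins_le_winBound : ∀ (r p q : Option Bool) (a b : Bool),
    (∑ u, if Wins (fun v _ => ![r, p, q] v) ![u, a, b] then 1 else 0) ≤ winBound p q a b := by
  decide

theorem sum_winBound_le : ∀ p₀ p₁ q₀ q₁ : Option Bool,
    ∑ a, ∑ b, winBound (cond b p₁ p₀) (cond a q₁ q₀) a b ≤ 5 := by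
  decide

theorem ncard_wins_DOne_le {S : Fin 3 → (Fin 3 → Bool) → Option Bool}
    (hS : IsStrategy DOne S) : {c : Fin 3 → Bool | Wins S c}.ncard ≤ 5 := by
  rw [ncard_wins, sum_config_three]
  refine le_trans (Finset.sum_le_sum fun a _ => Finset.sum_le_sum fun b _ => ?_)
    (sum_winBound_le (S 1 ![false, false, false]) (S 1 ![false, false, true])
      (S 2 ![false, false, false]) (S 2 ![false, true, false]))
  have hx : cond b (S 1 ![false, false, true]) (S 1 ![false, false, false]) =
      S 1 ![false, false, b] := by cases b <;> rfl
  have hy : cond a (S 2 ![false, true, false]) (S 2 ![false, false, false]) =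
      S 2 ![false, a, false] := by cases a <;> rfl
  rw [hx, hy]
  refine le_trans (Finset.sum_le_sum fun u _ => le_of_eq ?_)
    (sum_wins_le_winBound (S 0 ![false, a, b]) _ _ a b)
  refine if_congr (wins_congr fun v => ?_) rfl rfl
  fin_cases v <;> exact hS _ _ _ fun w => by fin_cases w <;> simp [DOne]

/-- `x` and `y` guess `true` on seeing `false`, and `u` guesses `true` on seeing `true` twice. -/
def optimalDOne (v : Fin 3) (c : Fin 3 → Bool) : Option Bool :=
  ![if c 1 && c 2 then some true else none,
    if c 2 then none else some true,
    if c 1 then none else some true] v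

theorem isStrategy_optimalDOne : IsStrategy DOne optimalDOne := by
  intro v c c' h
  fin_cases v <;> simp [DOne] at h <;> simp [optimalDOne, h]

theorem chance_optimalDOne : chance optimalDOne = 5 / 8 := by
  have h : (∑ c, if Wins optimalDOne c then 1 else 0) = 5 := by decide
  rw [chance, ncard_wins, h]
  norm_num

/-- `h(D₁) = 5/8`. -/
theorem hatNumber_DOne : hatNumber DOne = 5 / 8 := by
  refine le_antisymm (hatNumber_le fun S hS => ?_)
    (chance_optimalDOne ▸ chance_le_hatNumber isStrategy_optimalDOne)
  have h : ({c : Fin 3 → Bool | Wins S c}.ncard : ℚ) ≤ 5 := mod_cast ncard_wins_DOne_le hS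
  rw [chance, Fintype.card_fin]
  linarith

end HatProblem
end

section
/- For every ε > 0 there exists a digraph D with clique number ω(D) = 2 such that h(D) > 2/3 − ε. -/
namespace HatProblem

/-- The chance of success of a strategy is a lower bound for the hat number of any isomorphic
copy of its digraph. -/
theorem chance_le_hatNumber_of_equiv {V W : Type*} [Fintype V] [DecidableEq V] [Fintype W]
    [DecidableEq W] (e : W ≃ V) {A : V → V → Prop} {S : V → (V → Bool) → Option Bool}
    (hS : IsStrategy A S) : chance S ≤ hatNumber fun x y => A (e x) (e y) := by
  have hT : IsStrategy (fun x y => A (e x) (e y)) fun x c => S (e x) (c ∘ e.symm) := by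
    intro v c c' h
    refine hS _ _ _ fun u hu => h _ ?_
    simpa using hu
  refine le_trans (le_of_eq ?_) (chance_le_hatNumber hT)
  unfold chance
  rw [Fintype.card_congr e]
  congr 2
  refine Set.ncard_congr' ((e.arrowCongr (Equiv.refl Bool)).symm.subtypeEquiv fun c => ?_)
  have hc : ((e.arrowCongr (Equiv.refl Bool)).symm c) ∘ e.symm = c := by
    funext x
    simp [Equiv.arrowCongr]
  simp only [Set.mem_ofPred_eq, Wins, hc]
  simp [Equiv.arrowCongr, e.surjective.exists, e.surjective.forall]

/-- The directed union of `k` copies of `K₂`, each seeing all the previous ones. -/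
def edgeTower (k : ℕ) (x y : Fin k × Bool) : Prop :=
  y.1 < x.1 ∨ x.1 = y.1 ∧ x.2 ≠ y.2

theorem cliqueNum_edgeTower_of_equiv {k : ℕ} {W : Type*} [Fintype W] [DecidableEq W]
    (e : W ≃ Fin (k + 1) × Bool) :
    cliqueNum (fun x y => edgeTower (k + 1) (e x) (e y)) = 2 := by
  refine IsGreatest.csSup_eq ⟨⟨{e.symm (0, false), e.symm (0, true)}, ?_, ?_⟩, ?_⟩
  · intro x hx y hy hxy
    simp only [Finset.mem_insert, Finset.mem_singleton] at hx hy
    rcases hx with rfl | rfl <;> rcases hy with rfl | rfl <;> simp_all [edgeTower]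
  · exact Finset.card_pair (by simp)
  · rintro n ⟨s, hs, rfl⟩
    refine le_trans (Finset.card_le_card_of_injOn (fun x => (e x).2)
      (t := Finset.univ) (fun _ _ => Finset.mem_univ _) ?_) (by simp)
    intro x hx y hy hxy
    by_contra hne
    obtain ⟨h₁, h₂⟩ := hs x hx y hy hne
    simp only [edgeTower] at h₁ h₂ hxy
    rcases h₁ with h₁ | h₁
    · rcases h₂ with h₂ | h₂
      · exact lt_asymm h₁ h₂
      · exact h₂.2 hxy.symm
    · exact h₁.2 hxy

/-- A vertex guesses red exactly when all the previous edges are entirely red and its partner is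
blue. Here `true` is blue and `false` is red. -/
def towerStrategy (k : ℕ) (v : Fin k × Bool) (c : Fin k × Bool → Bool) : Option Bool :=
  if (∀ j < v.1, ∀ b, c (j, b) = false) ∧ c (v.1, !v.2) = true then some false else none

theorem isStrategy_towerStrategy (k : ℕ) : IsStrategy (edgeTower k) (towerStrategy k) := by
  rintro ⟨i, b⟩ c c' h
  have h₁ : ∀ j < i, ∀ b, c (j, b) = c' (j, b) := fun j hj b => h _ (Or.inl hj)
  have h₂ : c (i, !b) = c' (i, !b) := h _ (Or.inr ⟨rfl, by simp⟩)
  have h₃ : (∀ j < i, ∀ b, c (j, b) = false) ↔ ∀ j < i, ∀ b, c' (j, b) = false :=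
    forall₃_congr fun j hj b => by rw [h₁ j hj b]
  simp only [towerStrategy, h₂, h₃]

/-- The first pair that is not entirely red exists and is bichromatic. -/
def FirstMixed {k : ℕ} (d : Fin k → Bool × Bool) : Prop :=
  ∃ i, (∀ j < i, d j = (false, false)) ∧ (d i).1 ≠ (d i).2

theorem FirstMixed.wins {k : ℕ} {c : Fin k × Bool → Bool}
    (h : FirstMixed fun i => (c (i, false), c (i, true))) : Wins (towerStrategy k) c := by
  obtain ⟨i, hlt, hne⟩ := h
  simp only [Prod.mk.injEq] at hlt hne
  have hred : ∀ j < i, ∀ b, c (j, b) = false := fun j hj b => by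
    cases b
    exacts [(hlt j hj).1, (hlt j hj).2]
  obtain ⟨b, hb, hb'⟩ : ∃ b, c (i, b) = false ∧ c (i, !b) = true := by
    cases h₀ : c (i, false)
    · exact ⟨false, h₀, by simpa [h₀] using hne.symm⟩
    · exact ⟨true, by simpa [h₀] using hne.symm, h₀⟩
  refine ⟨⟨(i, b), ?_⟩, ?_⟩
  · rw [hb, towerStrategy, if_pos ⟨hred, hb'⟩]
  · rintro ⟨j, b₁⟩ b₂ h
    simp only [towerStrategy] at h
    split_ifs at h with hg
    obtain ⟨hg₁, hg₂⟩ := hg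
    obtain rfl : false = b₂ := by simpa using h
    rcases lt_trichotomy j i with hj | rfl | hj
    · exact (hred j hj b₁).symm
    · by_cases hbb : b₁ = b
      · rw [hbb, hb]
      · obtain rfl : b = !b₁ := by cases b <;> cases b₁ <;> simp_all
        simp_all
    · simp_all

theorem firstMixed_cons {k : ℕ} (a : Bool × Bool) (d : Fin k → Bool × Bool) :
    FirstMixed (Fin.cons a d : Fin (k + 1) → Bool × Bool) ↔
      a.1 ≠ a.2 ∨ a = (false, false) ∧ FirstMixed d := by
  simp [FirstMixed, Fin.exists_fin_succ, Fin.forall_fin_succ, and_assoc]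

open Classical in
theorem three_mul_card_firstMixed_add_two (k : ℕ) :
    3 * (∑ d : Fin k → Bool × Bool, if FirstMixed d then 1 else 0) + 2 = 2 * 4 ^ k := by
  induction k with
  | zero => simp [FirstMixed]
  | succ k ih =>
    rw [← (Fin.consEquiv fun _ => Bool × Bool).sum_comp, Fintype.sum_prod_type]
    have hcons : ∀ (a : Bool × Bool) (d : Fin k → Bool × Bool),
        Fin.consEquiv (fun _ => Bool × Bool) (a, d) = Fin.cons a d := fun _ _ => rfl
    simp only [hcons, firstMixed_cons, Fintype.sum_prod_type, Fintype.sum_bool]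
    simp only [ne_eq, not_true_eq_false, Bool.true_eq_false, Bool.false_eq_true, Prod.mk.injEq,
      not_false_eq_true, true_or, false_and, and_false, or_self, false_or, true_and, if_true,
      if_false, and_self]
    simp only [Finset.sum_const, Finset.card_univ, Fintype.card_pi, Fintype.card_prod,
      Fintype.card_bool, Finset.prod_const, Fintype.card_fin, smul_eq_mul]
    simp only [← Finset.card_filter] at ih ⊢
    norm_num
    rw [pow_succ]
    omega

theorem two_thirds_sub_le_chance_towerStrategy (k : ℕ) :
    2 / 3 - 2 / 3 * (1 / 4) ^ k ≤ chance (towerStrategy k) := by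
  classical
  have hle : (∑ d : Fin k → Bool × Bool, if FirstMixed d then 1 else 0) ≤
      {c | Wins (towerStrategy k) c}.ncard := by
    rw [← Finset.card_filter, ← Set.ncard_coe_finset]
    refine Set.ncard_le_ncard_of_injOn
      (fun d x => if x.2 then (d x.1).2 else (d x.1).1) ?_ ?_ (Set.toFinite _)
    · intro d hd
      exact FirstMixed.wins (by simpa using hd)
    · intro d _ d' _ h
      funext i
      exact Prod.ext (by simpa using congrFun h (i, false)) (by simpa using congrFun h (i, true))
  have hcount := three_mul_card_firstMixed_add_two k
  have hcard : 2 * 4 ^ k ≤ 3 * {c | Wins (towerStrategy k) c}.ncard + 2 := by omega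
  have hcard' : (2 * 4 ^ k : ℚ) ≤ 3 * ({c | Wins (towerStrategy k) c}.ncard : ℚ) + 2 := by
    exact_mod_cast hcard
  have hpow : (2 : ℚ) ^ Fintype.card (Fin k × Bool) = 4 ^ k := by
    rw [Fintype.card_prod, Fintype.card_fin, Fintype.card_bool, mul_comm, pow_mul]
    norm_num
  have hpos : (0 : ℚ) < 4 ^ k := by positivity
  rw [chance, hpow, le_div_iff₀ hpos, sub_mul, mul_assoc, ← mul_pow]
  norm_num
  linarith

/-- For every `ε > 0` there exists a digraph `D` with `ω(D) = 2` and `h(D) > 2/3 - ε`. -/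
theorem exists_digraph_cliqueNum_two_hatNumber_gt (ε : ℚ) (hε : 0 < ε) :
    ∃ (n : ℕ) (A : Fin n → Fin n → Prop), Irreflexive A ∧ cliqueNum A = 2 ∧
      2 / 3 - ε < hatNumber A := by
  obtain ⟨k, hk⟩ := exists_pow_lt_of_lt_one hε (by norm_num : (1 / 4 : ℚ) < 1)
  let e : Fin ((k + 1) * 2) ≃ Fin (k + 1) × Bool :=
    finProdFinEquiv.symm.trans ((Equiv.refl _).prodCongr finTwoEquiv)
  refine ⟨(k + 1) * 2, fun x y => edgeTower (k + 1) (e x) (e y), ?_,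
    cliqueNum_edgeTower_of_equiv e, ?_⟩
  · intro x hx
    simp [edgeTower] at hx
  · have hchance := (two_thirds_sub_le_chance_towerStrategy (k + 1)).trans
      (chance_le_hatNumber_of_equiv e (isStrategy_towerStrategy (k + 1)))
    have hpos : (0 : ℚ) < (1 / 4) ^ k := by positivity
    rw [pow_succ] at hchance
    linarith

end HatProblem
end
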